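/- arXiv:2501.07094 — 2 statements merged into one kernel-verified Lean document; each statement's English description precedes it below -/
import Mathlib

section
/- Fix positive integers N and K and set M = N(K+1). Let α > 0, γ > 0, C_1, …, C_K ∈ ℝ, and let A_k, B_k, C_k, D_k ∈ ℂ^{M×M} be Hermitian positive definite for k = 1, …, K. For nonzero f̄ ∈ ℂ^M define the quadratic forms a_k = Re(f̄^H A_k f̄), b_k = Re(f̄^H B_k f̄), c_k = Re(f̄^H C_k f̄), d_k = Re(f̄^H D_k f̄), the Lagrangian λ(f̄) = −α log( Σ_k exp(−(1/α)(C_k + log₂(a_k/b_k))) ) − γ( Σ_ℓ C_ℓ + α log( Σ_k exp(−(1/α) log₂(c_k/d_k)) ) ), the weights w_k = exp(−(1/α)(C_k + log₂(a_k/b_k))) / Σ_ℓ exp(−(1/α)(C_ℓ + log₂(a_ℓ/b_ℓ))) and v_k = exp(−(1/α) log₂(c_k/d_k)) / Σ_ℓ exp(−(1/α) log₂(c_ℓ/d_ℓ)), and the matrices X_KKT(f̄) = Σ_k ( w_k · A_k / a_k + γ v_k · C_k / c_k ) and Y_KKT(f̄) = Σ_k ( w_k · B_k / b_k + γ v_k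 · D_k / d_k ). Then the real Fréchet derivative of λ at f̄ vanishes if and only if X_KKT(f̄) · f̄ = Y_KKT(f̄) · f̄; in particular, at any such stationary point f̄ is an eigenvector of Y_KKT(f̄)⁻¹ X_KKT(f̄). -/
open Matrix ComplexOrder

/-- The LogSumExp-smoothed Lagrangian of the max-min fairness RSMA precoding problem,
built from the Rayleigh-quotient matrices `A_k, B_k` (private) and `Cm_k, D_k` (common). -/
noncomputable def lagr {M K : ℕ} (α γ : ℝ) (C : Fin K → ℝ)
    (A B Cm D : Fin K → Matrix (Fin M) (Fin M) ℂ) (f : Fin M → ℂ) : ℝ :=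
  -α * Real.log (∑ k, Real.exp (-(1 / α) * (C k +
      Real.logb 2
        ((star f ⬝ᵥ (A k).mulVec f).re / (star f ⬝ᵥ (B k).mulVec f).re)))) -
    γ * (∑ ℓ, C ℓ + α * Real.log (∑ k, Real.exp (-(1 / α) *
      Real.logb 2
        ((star f ⬝ᵥ (Cm k).mulVec f).re / (star f ⬝ᵥ (D k).mulVec f).re))))

/-- The real linear functional `x ↦ Re (xᴴ u)`. -/
noncomputable def reDotProduct {n : Type*} [Fintype n] (u : n → ℂ) : (n → ℂ) →L[ℝ] ℝ :=
  LinearMap.toContinuousLinearMap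
    { toFun := fun x => (star x ⬝ᵥ u).re
      map_add' := fun x y => by simp [add_dotProduct]
      map_smul' := fun c x => by simp [dotProduct, Finset.mul_sum, mul_assoc] }

theorem reDotProduct_apply {n : Type*} [Fintype n] (u x : n → ℂ) :
    reDotProduct u x = (star x ⬝ᵥ u).re := rfl

theorem reDotProduct_eq_zero_iff {n : Type*} [Fintype n] (u : n → ℂ) :
    reDotProduct u = 0 ↔ u = 0 := by
  constructor
  · intro h
    have h1 : (star u ⬝ᵥ u).re = 0 := by rw [← reDotProduct_apply, h]; rfl
    have h2 : 0 ≤ star u ⬝ᵥ u := dotProduct_star_self_nonneg u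
    refine dotProduct_star_self_eq_zero.1 ?_
    exact Complex.ext h1 (Complex.le_def.1 h2).2.symm
  · rintro rfl
    ext x
    simp [reDotProduct_apply]

theorem reDotProduct_add {n : Type*} [Fintype n] (u v : n → ℂ) :
    reDotProduct (u + v) = reDotProduct u + reDotProduct v := by
  ext x
  simp [reDotProduct_apply, dotProduct_add]

theorem reDotProduct_sub {n : Type*} [Fintype n] (u v : n → ℂ) :
    reDotProduct (u - v) = reDotProduct u - reDotProduct v := by
  ext x
  simp [reDotProduct_apply, dotProduct_sub]

theorem reDotProduct_ofReal_smul {n : Type*} [Fintype n] (c : ℝ) (u : n → ℂ) :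
    reDotProduct ((c : ℂ) • u) = c • reDotProduct u := by
  ext x
  simp [reDotProduct_apply, dotProduct_smul]

theorem reDotProduct_sum {n ι : Type*} [Fintype n] (s : Finset ι) (u : ι → n → ℂ) :
    reDotProduct (∑ i ∈ s, u i) = ∑ i ∈ s, reDotProduct (u i) := by
  ext x
  simp [reDotProduct_apply, dotProduct_sum]

/-- The real derivative of the quadratic form of a Hermitian matrix. -/
theorem Matrix.IsHermitian.hasFDerivAt_re_quadForm {n : Type*} [Fintype n]
    {A : Matrix n n ℂ} (hA : A.IsHermitian) (f : n → ℂ) :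
    HasFDerivAt (𝕜 := ℝ) (fun x : n → ℂ => (star x ⬝ᵥ A *ᵥ x).re)
      ((2 : ℝ) • reDotProduct (A *ᵥ f)) f := by
  have hsymm : ∀ x y : n → ℂ, (star x ⬝ᵥ A *ᵥ y).re = (star y ⬝ᵥ A *ᵥ x).re := by
    intro x y
    rw [← Complex.conj_re (star y ⬝ᵥ A *ᵥ x), ← Complex.star_def, star_dotProduct, star_mulVec,
      hA.eq, dotProduct_mulVec]
  let b : (n → ℂ) →ₗ[ℝ] (n → ℂ) →ₗ[ℝ] ℝ := LinearMap.mk₂ ℝ (fun x y => (star x ⬝ᵥ A *ᵥ y).re)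
    (fun x y z => by simp [add_dotProduct])
    (fun c x y => by simp [smul_dotProduct])
    (fun x y z => by simp [mulVec_add, dotProduct_add])
    (fun c x y => by simp [mulVec_smul, dotProduct_smul])
  have h := (b.toContinuousBilinearMap).hasFDerivAt_of_bilinear
    (hasFDerivAt_id (𝕜 := ℝ) f) (hasFDerivAt_id (𝕜 := ℝ) f)
  refine h.congr_fderiv ?_
  ext x
  have h1 : b f x = b x f := hsymm f x
  have h2 : b x f = reDotProduct (A *ᵥ f) x := rfl
  simp [h1, h2, two_mul]

theorem Matrix.PosDef.re_quadForm_pos {n : Type*} [Fintype n]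
    {A : Matrix n n ℂ} (hA : A.PosDef) {f : n → ℂ} (hf : f ≠ 0) :
    0 < (star f ⬝ᵥ A *ᵥ f).re :=
  hA.re_dotProduct_pos hf

/-- The real derivative of the base-two logarithm of a Rayleigh quotient. -/
theorem Matrix.PosDef.hasFDerivAt_logb_rayleigh {n : Type*} [Fintype n]
    {A B : Matrix n n ℂ} (hA : A.PosDef) (hB : B.PosDef) {f : n → ℂ} (hf : f ≠ 0) :
    HasFDerivAt (𝕜 := ℝ)
      (fun x : n → ℂ => Real.logb 2 ((star x ⬝ᵥ A *ᵥ x).re / (star x ⬝ᵥ B *ᵥ x).re))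
      ((2 / Real.log 2) • ((star f ⬝ᵥ A *ᵥ f).re⁻¹ • reDotProduct (A *ᵥ f) -
        (star f ⬝ᵥ B *ᵥ f).re⁻¹ • reDotProduct (B *ᵥ f))) f := by
  have ha := hA.re_quadForm_pos hf
  have hb := hB.re_quadForm_pos hf
  have hA' := hA.isHermitian.hasFDerivAt_re_quadForm f
  have hB' := hB.isHermitian.hasFDerivAt_re_quadForm f
  have h := ((hA'.log ha.ne').sub (hB'.log hb.ne')).const_mul (Real.log 2)⁻¹
  refine (h.congr_of_eventuallyEq ?_).congr_fderiv ?_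
  · filter_upwards [hA'.continuousAt.eventually_ne ha.ne',
      hB'.continuousAt.eventually_ne hb.ne'] with x hx hy
    simp only [Real.logb, Pi.sub_apply]
    rw [Real.log_div hx hy, div_eq_inv_mul]
  · ext x
    simp
    ring

/-- The derivative of the LogSumExp function is the softmax-weighted sum of derivatives. -/
theorem HasFDerivAt.log_sum_exp {E ι : Type*} [NormedAddCommGroup E] [NormedSpace ℝ E]
    [Fintype ι] [Nonempty ι] {g : ι → E → ℝ} {g' : ι → E →L[ℝ] ℝ} {x : E}
    (hg : ∀ i, HasFDerivAt (g i) (g' i) x) :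
    HasFDerivAt (fun y => Real.log (∑ i, Real.exp (g i y)))
      (∑ i, (Real.exp (g i x) / ∑ j, Real.exp (g j x)) • g' i) x := by
  have hS : 0 < ∑ j, Real.exp (g j x) :=
    Finset.sum_pos (fun i _ => Real.exp_pos _) Finset.univ_nonempty
  have h := (HasFDerivAt.fun_sum (u := Finset.univ) fun i _ => (hg i).exp).log hS.ne'
  refine h.congr_fderiv ?_
  rw [Finset.smul_sum]
  exact Finset.sum_congr rfl fun i _ => by rw [smul_smul, div_eq_inv_mul]

theorem Matrix.PosDef.sum_ofReal_smul {n ι : Type*} [Fintype n] [Fintype ι] [Nonempty ι]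
    {B D : ι → Matrix n n ℂ} (hB : ∀ i, (B i).PosDef) (hD : ∀ i, (D i).PosDef)
    {r s : ι → ℝ} (hr : ∀ i, 0 < r i) (hs : ∀ i, 0 < s i) :
    (∑ i, ((r i : ℂ) • B i + (s i : ℂ) • D i)).PosDef :=
  Matrix.posDef_sum Finset.univ_nonempty fun i _ =>
    ((hB i).smul (Complex.zero_lt_real.2 (hr i))).add ((hD i).smul (Complex.zero_lt_real.2 (hs i)))

theorem hasFDerivAt_lagr {M K : ℕ} (hK : 0 < K) {α : ℝ} (hα : α ≠ 0) (γ : ℝ) (C : Fin K → ℝ)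
    {A B Cm D : Fin K → Matrix (Fin M) (Fin M) ℂ}
    (hA : ∀ k, (A k).PosDef) (hB : ∀ k, (B k).PosDef)
    (hCm : ∀ k, (Cm k).PosDef) (hD : ∀ k, (D k).PosDef)
    {f : Fin M → ℂ} (hf : f ≠ 0) {qa qb qc qd : Fin K → ℝ}
    (hqa : ∀ k, qa k = (star f ⬝ᵥ (A k).mulVec f).re)
    (hqb : ∀ k, qb k = (star f ⬝ᵥ (B k).mulVec f).re)
    (hqc : ∀ k, qc k = (star f ⬝ᵥ (Cm k).mulVec f).re)
    (hqd : ∀ k, qd k = (star f ⬝ᵥ (D k).mulVec f).re)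
    {w v : Fin K → ℝ}
    (hw : ∀ k, w k = Real.exp (-(1 / α) * (C k + Real.logb 2 (qa k / qb k))) /
      ∑ ℓ, Real.exp (-(1 / α) * (C ℓ + Real.logb 2 (qa ℓ / qb ℓ))))
    (hv : ∀ k, v k = Real.exp (-(1 / α) * Real.logb 2 (qc k / qd k)) /
      ∑ ℓ, Real.exp (-(1 / α) * Real.logb 2 (qc ℓ / qd ℓ))) :
    HasFDerivAt (lagr α γ C A B Cm D)
      ((2 / Real.log 2) • reDotProduct
        ((∑ k, (((w k / qa k : ℝ) : ℂ) • A k + ((γ * v k / qc k : ℝ) : ℂ) • Cm k)) *ᵥ f -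
          (∑ k, (((w k / qb k : ℝ) : ℂ) • B k + ((γ * v k / qd k : ℝ) : ℂ) • D k)) *ᵥ f)) f := by
  have : Nonempty (Fin K) := ⟨⟨0, hK⟩⟩
  have h1 := HasFDerivAt.log_sum_exp fun k =>
    (((hA k).hasFDerivAt_logb_rayleigh (hB k) hf).const_add (C k)).const_mul (-(1 / α))
  have h2 := HasFDerivAt.log_sum_exp fun k =>
    ((hCm k).hasFDerivAt_logb_rayleigh (hD k) hf).const_mul (-(1 / α))
  simp only [← hqa, ← hqb, ← hqc, ← hqd, ← hw, ← hv] at h1 h2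
  refine ((h1.const_mul (-α)).sub
    (((h2.const_mul α).const_add (∑ ℓ, C ℓ)).const_mul γ)).congr_fderiv ?_
  simp only [sum_mulVec, add_mulVec, smul_mulVec, reDotProduct_sub, reDotProduct_sum,
    reDotProduct_add, reDotProduct_ofReal_smul]
  simp only [Finset.smul_sum, ← Finset.sum_sub_distrib]
  refine Finset.sum_congr rfl fun k _ => ?_
  ext x
  simp
  field_simp
  ring

/-- Lemma 1 of the paper: at a nonzero `f̄`, the real Fréchet derivative of the
LogSumExp-smoothed Lagrangian vanishes iff `X_KKT(f̄) f̄ = Y_KKT(f̄) f̄`; in particular,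
at any such stationary point, `f̄` is an eigenvector of `Y_KKT(f̄)⁻¹ X_KKT(f̄)`. -/
theorem kkt_eigenvector_condition (N K : ℕ) (hN : 0 < N) (hK : 0 < K)
    (α γ : ℝ) (hα : 0 < α) (hγ : 0 < γ)
    (C : Fin K → ℝ)
    (A B Cm D : Fin K → Matrix (Fin (N * (K + 1))) (Fin (N * (K + 1))) ℂ)
    (hA : ∀ k, (A k).PosDef) (hB : ∀ k, (B k).PosDef)
    (hCm : ∀ k, (Cm k).PosDef) (hD : ∀ k, (D k).PosDef)
    (fbar : Fin (N * (K + 1)) → ℂ) (hf : fbar ≠ 0)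
    (qa qb qc qd : Fin K → ℝ)
    (hqa : ∀ k, qa k = (star fbar ⬝ᵥ (A k).mulVec fbar).re)
    (hqb : ∀ k, qb k = (star fbar ⬝ᵥ (B k).mulVec fbar).re)
    (hqc : ∀ k, qc k = (star fbar ⬝ᵥ (Cm k).mulVec fbar).re)
    (hqd : ∀ k, qd k = (star fbar ⬝ᵥ (D k).mulVec fbar).re)
    (w v : Fin K → ℝ)
    (hw : ∀ k, w k = Real.exp (-(1 / α) * (C k + Real.logb 2 (qa k / qb k))) /
      ∑ ℓ, Real.exp (-(1 / α) * (C ℓ + Real.logb 2 (qa ℓ / qb ℓ))))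
    (hv : ∀ k, v k = Real.exp (-(1 / α) * Real.logb 2 (qc k / qd k)) /
      ∑ ℓ, Real.exp (-(1 / α) * Real.logb 2 (qc ℓ / qd ℓ)))
    (X Y : Matrix (Fin (N * (K + 1))) (Fin (N * (K + 1))) ℂ)
    (hX : X = ∑ k, (((w k / qa k : ℝ) : ℂ) • A k +
      ((γ * v k / qc k : ℝ) : ℂ) • Cm k))
    (hY : Y = ∑ k, (((w k / qb k : ℝ) : ℂ) • B k +
      ((γ * v k / qd k : ℝ) : ℂ) • D k)) :
    (fderiv ℝ (lagr α γ C A B Cm D) fbar = 0 ↔ X.mulVec fbar = Y.mulVec fbar) ∧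
      (X.mulVec fbar = Y.mulVec fbar → (Y⁻¹ * X).mulVec fbar = fbar) := by
  have : Nonempty (Fin K) := ⟨⟨0, hK⟩⟩
  constructor
  · rw [(hasFDerivAt_lagr hK hα.ne' γ C hA hB hCm hD hf hqa hqb hqc hqd hw hv).fderiv, ← hX, ← hY,
      smul_eq_zero, reDotProduct_eq_zero_iff, sub_eq_zero]
    have h2 : 2 / Real.log 2 ≠ 0 := (div_pos two_pos (Real.log_pos one_lt_two)).ne'
    simp [h2]
  · intro h
    have hw0 : ∀ k, 0 < w k := fun k => by
      rw [hw]
      exact div_pos (Real.exp_pos _)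
        (Finset.sum_pos (fun i _ => Real.exp_pos _) Finset.univ_nonempty)
    have hv0 : ∀ k, 0 < v k := fun k => by
      rw [hv]
      exact div_pos (Real.exp_pos _)
        (Finset.sum_pos (fun i _ => Real.exp_pos _) Finset.univ_nonempty)
    have hY' : Y.PosDef := hY ▸ Matrix.PosDef.sum_ofReal_smul hB hD
      (fun k => div_pos (hw0 k) (hqb k ▸ (hB k).re_quadForm_pos hf))
      (fun k => div_pos (mul_pos hγ (hv0 k)) (hqd k ▸ (hD k).re_quadForm_pos hf))
    rw [← mulVec_mulVec, h, mulVec_mulVec,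
      nonsing_inv_mul _ ((isUnit_iff_isUnit_det Y).1 hY'.isUnit), one_mulVec]
end

section
/- Let K be a positive integer, r : Fin K → ℝ, S > 0, and let μ ∈ ℝ satisfy Σ_{k} max(μ − r_k, 0) = S. Then: (i) for every c : Fin K → ℝ with c_k ≥ 0 for all k and Σ_k c_k ≤ S, we have min_k (c_k + r_k) ≤ μ; and (ii) the allocation c*_k = max(μ − r_k, 0) satisfies c*_k ≥ 0, Σ_k c*_k = S, and min_k (c*_k + r_k) = μ. Hence the maximum of min_k (c_k + r_k) over all feasible allocations equals μ and is attained by the waterfilling allocation c*. -/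
/-- If the positive parts `(μ − r_k)^+` have positive sum, some level `r_k` lies below `μ`. -/
theorem exists_lt_of_sum_max_sub_pos {ι : Type*} [Fintype ι] {r : ι → ℝ} {μ : ℝ}
    (h : 0 < ∑ k, max (μ - r k) 0) : ∃ k, r k < μ := by
  obtain ⟨k, -, hk⟩ := Finset.exists_lt_of_sum_lt (s := Finset.univ) (f := fun _ : ι => (0 : ℝ))
    (by simpa using h)
  exact ⟨k, by simpa using hk⟩

/-- A nonnegative allocation whose budget is that of the waterfilling allocation at level `μ`
leaves some index at level at most `μ`. -/
theorem exists_add_le_of_sum_le_sum_max_sub {ι : Type*} [Fintype ι] {r c : ι → ℝ} {μ : ℝ}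
    (h : 0 < ∑ k, max (μ - r k) 0) (hc : ∀ k, 0 ≤ c k)
    (hsum : ∑ k, c k ≤ ∑ k, max (μ - r k) 0) : ∃ k, c k + r k ≤ μ := by
  by_contra! hlt
  obtain ⟨j, hj⟩ := exists_lt_of_sum_max_sub_pos h
  refine hsum.not_gt (Finset.sum_lt_sum (fun k _ => max_le ?_ (hc k)) ⟨j, Finset.mem_univ j, ?_⟩)
  · linarith [hlt k]
  · rw [max_eq_left (by linarith)]
    linarith [hlt j]

/-- Optimality of the waterfilling allocation: if `Σ_k (μ − r_k)^+ = S` with `S > 0`, then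
(i) every feasible allocation `c` (`c_k ≥ 0`, `Σ_k c_k ≤ S`) has `min_k (c_k + r_k) ≤ μ`,
and (ii) the waterfilling allocation `c*_k = (μ − r_k)^+` is feasible with `Σ_k c*_k = S`
and attains `min_k (c*_k + r_k) = μ`. -/
theorem waterfilling_optimal (K : ℕ) (hK : 0 < K) (r : Fin K → ℝ)
    (S : ℝ) (hS : 0 < S) (μ : ℝ) (hμ : ∑ k, max (μ - r k) 0 = S) :
    (∀ c : Fin K → ℝ, (∀ k, 0 ≤ c k) → (∑ k, c k) ≤ S →
        (⨅ k, (c k + r k)) ≤ μ) ∧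
      (∀ k, 0 ≤ max (μ - r k) 0) ∧
      (∑ k, max (μ - r k) 0 = S) ∧
      (⨅ k, (max (μ - r k) 0 + r k)) = μ := by
  subst hμ
  have : Nonempty (Fin K) := ⟨⟨0, hK⟩⟩
  have iInf_le_level : ∀ c : Fin K → ℝ, (∀ k, 0 ≤ c k) →
      (∑ k, c k) ≤ ∑ k, max (μ - r k) 0 → (⨅ k, (c k + r k)) ≤ μ := by
    intro c hc hsum
    obtain ⟨k, hk⟩ := exists_add_le_of_sum_le_sum_max_sub hS hc hsum
    exact (ciInf_le (Set.finite_range _).bddBelow k).trans hk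
  have hnonneg : ∀ k, 0 ≤ max (μ - r k) 0 := fun k => le_max_right _ _
  refine ⟨iInf_le_level, hnonneg, rfl, (iInf_le_level _ hnonneg le_rfl).antisymm ?_⟩
  exact le_ciInf fun k => by linarith [le_max_left (μ - r k) 0]
end
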